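/- arXiv:2408.08177 — 3 statements merged into one kernel-verified Lean document; each statement's English description precedes it below -/
import Mathlib

section
/- Let A and B be p×p Hermitian positive semidefinite complex matrices, let 1 ≤ d < p, and assume λ_d(A) ≥ λ_{d+1}(B). Let U be a p×d complex matrix with orthonormal columns satisfying A U = U Λ_A, where Λ_A = diag(λ_1(A),…,λ_d(A)), and let W be a p×(p−d) complex matrix with orthonormal columns satisfying B W = W Λ_B, where Λ_B = diag(λ_{d+1}(B),…,λ_p(B)). Then (λ_d(A) − λ_{d+1}(B)) · ‖U†W‖_op ≤ ‖A − B‖_op. -/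
open Matrix ComplexOrder

/-- Operator norm (largest singular value) of a complex matrix. -/
noncomputable def opNorm {m n : Type*} [Fintype m] [Fintype n] [DecidableEq n]
    (A : Matrix m n ℂ) : ℝ :=
  ‖LinearMap.toContinuousLinearMap (Matrix.toEuclideanLin A)‖

open scoped Matrix.Norms.L2Operator in
lemma opNorm_eq_norm {m n : Type*} [Fintype m] [Fintype n] [DecidableEq n]
    (A : Matrix m n ℂ) : opNorm A = ‖A‖ := rfl

open scoped Matrix.Norms.L2Operator in
/-- A matrix with orthonormal columns has operator norm at most one. -/
lemma norm_le_one_of_conjTranspose_mul_self {m n : Type*} [Fintype m] [Fintype n]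
    [DecidableEq n] {U : Matrix m n ℂ} (hU : Uᴴ * U = 1) : ‖U‖ ≤ 1 := by
  have h := l2_opNorm_conjTranspose_mul_self U
  have h1 : ‖(1 : Matrix n n ℂ)‖ ≤ 1 := by
    rw [← diagonal_one, l2_opNorm_diagonal]
    exact (pi_norm_le_iff_of_nonneg zero_le_one).2 fun i => by simp
  rw [hU] at h
  nlinarith [norm_nonneg U]

open scoped Matrix.Norms.L2Operator in
/-- Left multiplication by a diagonal matrix with entries at least `a` expands the operator
norm by a factor of at least `a`. -/
lemma mul_norm_le_norm_diagonal_mul {m n : Type*} [Fintype m] [Fintype n] [DecidableEq m]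
    [DecidableEq n] {α : m → ℝ} {a : ℝ} (hα : ∀ i, a ≤ α i) (X : Matrix m n ℂ) :
    a * ‖X‖ ≤ ‖diagonal (fun i => (α i : ℂ)) * X‖ := by
  rcases le_or_gt a 0 with ha | ha
  · exact (mul_nonpos_of_nonpos_of_nonneg ha (norm_nonneg X)).trans (norm_nonneg _)
  have hX : X = diagonal (fun i => ((α i)⁻¹ : ℂ)) * (diagonal (fun i => (α i : ℂ)) * X) := by
    ext i j
    have : (α i : ℂ) ≠ 0 := by exact_mod_cast (ha.trans_le (hα i)).ne'
    simp [diagonal_mul, this]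
  have hinv : ‖diagonal (fun i => ((α i)⁻¹ : ℂ))‖ ≤ a⁻¹ := by
    rw [l2_opNorm_diagonal]
    refine (pi_norm_le_iff_of_nonneg (inv_nonneg.2 ha.le)).2 fun i => ?_
    rw [norm_inv, Complex.norm_real, Real.norm_of_nonneg (ha.le.trans (hα i))]
    exact inv_anti₀ ha (hα i)
  calc a * ‖X‖
      ≤ a * (a⁻¹ * ‖diagonal (fun i => (α i : ℂ)) * X‖) := by
        gcongr
        conv_lhs => rw [hX]
        exact (l2_opNorm_mul _ _).trans (by gcongr)
    _ = ‖diagonal (fun i => (α i : ℂ)) * X‖ := by rw [mul_inv_cancel_left₀ ha.ne']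

open scoped Matrix.Norms.L2Operator in
/-- Lower bound for the operator norm of the Sylvester operator with diagonal coefficients. -/
lemma sub_mul_norm_le_norm_sylvester {m n : Type*} [Fintype m] [Fintype n] [DecidableEq m]
    [DecidableEq n] {α : m → ℝ} {β : n → ℝ} {a b : ℝ} (hb : 0 ≤ b) (hα : ∀ i, a ≤ α i)
    (hβ : ∀ j, |β j| ≤ b) (X : Matrix m n ℂ) :
    (a - b) * ‖X‖ ≤
      ‖diagonal (fun i => (α i : ℂ)) * X - X * diagonal (fun j => (β j : ℂ))‖ := by
  have hr : ‖X * diagonal (fun j => (β j : ℂ))‖ ≤ ‖X‖ * b := by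
    refine (l2_opNorm_mul _ _).trans ?_
    gcongr
    rw [l2_opNorm_diagonal]
    exact (pi_norm_le_iff_of_nonneg hb).2 fun j => by simpa using hβ j
  linarith [mul_norm_le_norm_diagonal_mul hα X,
    norm_sub_norm_le (diagonal (fun i => (α i : ℂ)) * X) (X * diagonal (fun j => (β j : ℂ)))]

/-- The eigenvalues in a unitary diagonalization of a positive semidefinite matrix are
nonnegative. -/
lemma nonneg_of_posSemidef_unitary_conj {n : Type*} [Fintype n] [DecidableEq n]
    {B V : Matrix n n ℂ} (hB : B.PosSemidef) (hV : V ∈ Matrix.unitaryGroup n ℂ) {μ : n → ℝ}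
    (h : B = V * diagonal (fun i => (μ i : ℂ)) * Vᴴ) (i : n) : 0 ≤ μ i := by
  have hV' : Vᴴ * V = 1 := Matrix.mem_unitaryGroup_iff'.1 hV
  have hD : Vᴴ * B * V = diagonal (fun i => (μ i : ℂ)) := by
    rw [h, Matrix.mul_assoc V, ← Matrix.mul_assoc Vᴴ V, hV', Matrix.one_mul, Matrix.mul_assoc,
      hV', Matrix.mul_one]
  have hP := hB.conjTranspose_mul_mul_same V
  rw [hD, posSemidef_diagonal_iff] at hP
  exact_mod_cast hP i

/-- Sin-theta perturbation inequality: if `A, B` are Hermitian PSD with eigenvalues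
`μA, μB` in nonincreasing order, `λ_d(A) ≥ λ_{d+1}(B)`, `U` has orthonormal columns
spanning the top-`d` eigenspace of `A` (`AU = UΛ_A`), and `W` has orthonormal columns with
`BW = WΛ_B` for the bottom `p−d` eigenvalues of `B`, then
`(λ_d(A) − λ_{d+1}(B))‖U†W‖_op ≤ ‖A − B‖_op`. -/
theorem sin_theta_inequality {p d : ℕ} (hd : 1 ≤ d) (hdp : d < p)
    (A B : Matrix (Fin p) (Fin p) ℂ) (hA : A.PosSemidef) (hB : B.PosSemidef)
    (μA μB : Fin p → ℝ) (hμA : Antitone μA) (hμB : Antitone μB)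
    (VA VB : Matrix (Fin p) (Fin p) ℂ)
    (hVA : VA ∈ Matrix.unitaryGroup (Fin p) ℂ) (hVB : VB ∈ Matrix.unitaryGroup (Fin p) ℂ)
    (hAdiag : A = VA * Matrix.diagonal (fun i => (μA i : ℂ)) * VAᴴ)
    (hBdiag : B = VB * Matrix.diagonal (fun i => (μB i : ℂ)) * VBᴴ)
    (hgap : μB ⟨d, hdp⟩ ≤ μA ⟨d - 1, by omega⟩)
    (U : Matrix (Fin p) (Fin d) ℂ) (hU : Uᴴ * U = 1)
    (hAU : A * U = U * Matrix.diagonal (fun i : Fin d => (μA ⟨i.1, by omega⟩ : ℂ)))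
    (W : Matrix (Fin p) (Fin (p - d)) ℂ) (hW : Wᴴ * W = 1)
    (hBW : B * W = W * Matrix.diagonal (fun j : Fin (p - d) => (μB ⟨d + j.1, by omega⟩ : ℂ))) :
    (μA ⟨d - 1, by omega⟩ - μB ⟨d, hdp⟩) * opNorm (Uᴴ * W) ≤ opNorm (A - B) := by
  open scoped Matrix.Norms.L2Operator in
  have hAh : Uᴴ * A = diagonal (fun i : Fin d => (μA ⟨i.1, by omega⟩ : ℂ)) * Uᴴ := by
    have h := congrArg conjTranspose hAU
    rw [conjTranspose_mul, conjTranspose_mul, hA.isHermitian.eq, diagonal_conjTranspose] at h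
    rw [h]
    congr 2
    ext i
    simp
  have hS : Uᴴ * (A - B) * W =
      diagonal (fun i : Fin d => (μA ⟨i.1, by omega⟩ : ℂ)) * (Uᴴ * W) -
        (Uᴴ * W) * diagonal (fun j : Fin (p - d) => (μB ⟨d + j.1, by omega⟩ : ℂ)) := by
    rw [Matrix.mul_sub, Matrix.sub_mul, hAh, Matrix.mul_assoc Uᴴ B, hBW, Matrix.mul_assoc,
      Matrix.mul_assoc]
  have hμB0 := nonneg_of_posSemidef_unitary_conj hB hVB hBdiag
  have hX := sub_mul_norm_le_norm_sylvester
    (α := fun i : Fin d => μA ⟨i.1, by omega⟩)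
    (β := fun j : Fin (p - d) => μB ⟨d + j.1, by omega⟩)
    (a := μA ⟨d - 1, by omega⟩) (b := μB ⟨d, hdp⟩) (hμB0 _)
    (fun i => hμA (Fin.mk_le_mk.2 (by omega)))
    (fun j => (abs_of_nonneg (hμB0 _)).trans_le (hμB (Fin.mk_le_mk.2 (by omega)))) (Uᴴ * W)
  rw [← hS] at hX
  rw [opNorm_eq_norm, opNorm_eq_norm]
  have hU1 : ‖Uᴴ‖ ≤ 1 :=
    (l2_opNorm_conjTranspose U).trans_le (norm_le_one_of_conjTranspose_mul_self hU)
  have hW1 := norm_le_one_of_conjTranspose_mul_self hW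
  calc _ ≤ ‖Uᴴ * (A - B) * W‖ := hX
    _ ≤ ‖Uᴴ‖ * ‖A - B‖ * ‖W‖ :=
        (l2_opNorm_mul _ _).trans (by gcongr; exact l2_opNorm_mul _ _)
    _ ≤ 1 * ‖A - B‖ * 1 := by gcongr
    _ = ‖A - B‖ := by ring
end

section
/- Let f be a p×p Hermitian positive semidefinite complex matrix, let 1 ≤ d < p, and let Π be the orthogonal projection onto the span of d orthonormal eigenvectors of f corresponding to its d largest eigenvalues λ_1(f),…,λ_d(f). Then for every θ ∈ [0,1], the smoothed matrix f^{(θ)} = (1−θ) f + θ Π f Π satisfies λ_{d+1}(f^{(θ)}) = (1−θ) λ_{d+1}(f). -/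
open Matrix ComplexOrder

/-- The roots of the characteristic polynomial of a unitarily diagonalized matrix are its diagonal
entries. -/
lemma Matrix.roots_charpoly_unitary_conj_diagonal {n : Type*} [Fintype n] [DecidableEq n]
    {V : Matrix n n ℂ} (hV : V ∈ Matrix.unitaryGroup n ℂ) (a : n → ℂ) :
    (V * Matrix.diagonal a * Vᴴ).charpoly.roots = Multiset.map a Finset.univ.val := by
  have hVV : Vᴴ * V = 1 := Matrix.mem_unitaryGroup_iff'.mp hV
  rw [Matrix.charpoly_mul_comm, ← mul_assoc, hVV, one_mul, Matrix.charpoly_diagonal,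
    Polynomial.roots_prod]
  · simp
  · simp [Finset.prod_ne_zero_iff, Polynomial.X_sub_C_ne_zero]

/-- An antitone family on `Fin n` is determined by its multiset of values. -/
lemma Antitone.eq_of_map_univ_eq {n : ℕ} {α : Type*} [LinearOrder α] {a b : Fin n → α}
    (ha : Antitone a) (hb : Antitone b)
    (h : Multiset.map a Finset.univ.val = Multiset.map b Finset.univ.val) : a = b := by
  rw [Fin.univ_val_map, Fin.univ_val_map, Multiset.coe_eq_coe] at h
  exact List.ofFn_injective (h.eq_of_sortedGE ha.sortedGE_ofFn hb.sortedGE_ofFn)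

/-- The nonincreasing eigenvalues of a unitarily diagonalizable matrix are unique. -/
lemma Matrix.antitone_unitary_diagonalization_unique {n : ℕ} {V W : Matrix (Fin n) (Fin n) ℂ}
    (hV : V ∈ Matrix.unitaryGroup (Fin n) ℂ) (hW : W ∈ Matrix.unitaryGroup (Fin n) ℂ)
    {a b : Fin n → ℝ} (ha : Antitone a) (hb : Antitone b)
    (h : V * Matrix.diagonal (fun i => (a i : ℂ)) * Vᴴ =
      W * Matrix.diagonal (fun i => (b i : ℂ)) * Wᴴ) : a = b := by
  have hroots := congrArg (fun M => M.charpoly.roots.map Complex.re) h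
  simp only [Matrix.roots_charpoly_unitary_conj_diagonal hV,
    Matrix.roots_charpoly_unitary_conj_diagonal hW, Multiset.map_map, Function.comp_def,
    Complex.ofReal_re] at hroots
  exact ha.eq_of_map_univ_eq hb hroots

/-- For a Hermitian PSD `f` with eigenvalues `μ` in nonincreasing order, `P` the orthogonal
projection onto the top-`d` eigenspace, and `θ ∈ [0,1]`, the smoothed matrix
`f^{(θ)} = (1−θ)f + θPfP` satisfies `λ_{d+1}(f^{(θ)}) = (1−θ)λ_{d+1}(f)`: in any unitary
diagonalization of `f^{(θ)}` with eigenvalues `ν` in nonincreasing order,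
`ν_{d+1} = (1−θ)μ_{d+1}`. -/
theorem smoothed_matrix_eigenvalue {p d : ℕ} (hd : 1 ≤ d) (hdp : d < p)
    (f : Matrix (Fin p) (Fin p) ℂ) (hf : f.PosSemidef)
    (μ : Fin p → ℝ) (hμ : Antitone μ)
    (V : Matrix (Fin p) (Fin p) ℂ) (hV : V ∈ Matrix.unitaryGroup (Fin p) ℂ)
    (hdiag : f = V * Matrix.diagonal (fun i => (μ i : ℂ)) * Vᴴ)
    (P : Matrix (Fin p) (Fin p) ℂ)
    (hP : P = V * Matrix.diagonal (fun i : Fin p => if (i : ℕ) < d then (1 : ℂ) else 0) * Vᴴ)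
    (θ : ℝ) (hθ0 : 0 ≤ θ) (hθ1 : θ ≤ 1)
    (fθ : Matrix (Fin p) (Fin p) ℂ)
    (hfθ : fθ = ((1 - θ : ℝ) : ℂ) • f + ((θ : ℝ) : ℂ) • (P * f * P))
    (ν : Fin p → ℝ) (hν : Antitone ν)
    (W : Matrix (Fin p) (Fin p) ℂ) (hW : W ∈ Matrix.unitaryGroup (Fin p) ℂ)
    (hfθdiag : fθ = W * Matrix.diagonal (fun i => (ν i : ℂ)) * Wᴴ) :
    ν ⟨d, hdp⟩ = (1 - θ) * μ ⟨d, hdp⟩ := by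
  have hVV : Vᴴ * V = 1 := Matrix.mem_unitaryGroup_iff'.mp hV
  have hμ0 : ∀ i, 0 ≤ μ i := by
    have h := hf.conjTranspose_mul_mul_same V
    have he : Vᴴ * f * V = Matrix.diagonal (fun i => (μ i : ℂ)) := by
      calc Vᴴ * f * V = (Vᴴ * V) * Matrix.diagonal (fun i => (μ i : ℂ)) * (Vᴴ * V) := by
            rw [hdiag]; simp only [mul_assoc]
        _ = _ := by rw [hVV, one_mul, mul_one]
    rw [he, Matrix.posSemidef_diagonal_iff] at h
    exact fun i => Complex.zero_le_real.mp (h i)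
  set g : Fin p → ℝ := fun i => if (i : ℕ) < d then μ i else (1 - θ) * μ i with hg
  have hg_anti : Antitone g := by
    intro i j hij
    have hm := hμ hij
    have hij' : (i : ℕ) ≤ j := hij
    simp only [hg]
    split_ifs with hj hi hi
    · exact hm
    · omega
    · nlinarith [hμ0 j]
    · exact mul_le_mul_of_nonneg_left hm (by linarith)
  set D := Matrix.diagonal (fun i => (μ i : ℂ)) with hD
  set E := Matrix.diagonal (fun i : Fin p => if (i : ℕ) < d then (1 : ℂ) else 0) with hE
  have hPfP : P * f * P = V * (E * D * E) * Vᴴ := by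
    calc P * f * P = V * E * (Vᴴ * V) * D * (Vᴴ * V) * E * Vᴴ := by
          rw [hP, hdiag]; simp only [mul_assoc]
      _ = _ := by rw [hVV]; simp only [mul_one, mul_assoc]
  have hgD : Matrix.diagonal (fun i => (g i : ℂ)) =
      ((1 - θ : ℝ) : ℂ) • D + ((θ : ℝ) : ℂ) • (E * D * E) := by
    rw [hD, hE, Matrix.diagonal_mul_diagonal, Matrix.diagonal_mul_diagonal,
      ← Matrix.diagonal_smul, ← Matrix.diagonal_smul, Matrix.diagonal_add]
    congr 1
    funext i
    by_cases hi : (i : ℕ) < d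
    · simp [hg, hi]; ring
    · simp [hg, hi]
  have hfg : V * Matrix.diagonal (fun i => (g i : ℂ)) * Vᴴ = fθ := by
    rw [hgD, hfθ, hPfP, hdiag]
    simp only [mul_add, add_mul, Matrix.mul_smul, Matrix.smul_mul]
  have hνg := Matrix.antitone_unitary_diagonalization_unique hV hW hg_anti hν (hfg.trans hfθdiag)
  rw [← hνg]
  simp [hg]
end

section
/- Let U and U' be p×d complex matrices with orthonormal columns (U†U = U'†U' = I_d), and let Ũ and Ũ' be the real (2p)×d matrices obtained by stacking the real part above the imaginary part: Ũ = [Re U; Im U], Ũ' = [Re U'; Im U']. Then ‖U U† − U' U'†‖_F ≤ 2 ‖Ũ Ũᵀ − Ũ' Ũ'ᵀ‖_F. -/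
open Matrix

/-- Frobenius norm `‖A‖_F = √(tr(A†A))` of a complex matrix. -/
noncomputable def frob {m n : Type*} [Fintype m] [Fintype n]
    (A : Matrix m n ℂ) : ℝ := Real.sqrt ((Matrix.trace (Aᴴ * A)).re)

/-- Frobenius norm `‖A‖_F = √(tr(AᵀA))` of a real matrix. -/
noncomputable def frobR {m n : Type*} [Fintype m] [Fintype n]
    (A : Matrix m n ℝ) : ℝ := Real.sqrt (Matrix.trace (Aᵀ * A))

/-- The squared Frobenius norm of a complex matrix is the sum of the squared moduli of its entries. -/
lemma re_trace_conjTranspose_mul_self {m n : Type*} [Fintype m] [Fintype n] (A : Matrix m n ℂ) :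
    ((Aᴴ * A).trace).re = ∑ j, ∑ i, ((A i j).re ^ 2 + (A i j).im ^ 2) := by
  simp [Matrix.trace, Matrix.mul_apply, pow_two]

/-- The squared Frobenius norm of a real matrix is the sum of the squares of its entries. -/
lemma trace_transpose_mul_self_eq_sum {m n : Type*} [Fintype m] [Fintype n] (A : Matrix m n ℝ) :
    (Aᵀ * A).trace = ∑ j, ∑ i, A i j ^ 2 := by
  simp [Matrix.trace, Matrix.mul_apply, pow_two]

/-- If the real part of `M` is the sum of the diagonal blocks of `D` and its imaginary part is the
difference of the off-diagonal blocks, then `‖M‖_F ≤ 2‖D‖_F`. -/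
lemma frob_le_two_mul_frobR_of_blocks {m : Type*} [Fintype m]
    (M : Matrix m m ℂ) (D : Matrix (m ⊕ m) (m ⊕ m) ℝ)
    (hre : ∀ i j, (M i j).re = D (.inl i) (.inl j) + D (.inr i) (.inr j))
    (him : ∀ i j, (M i j).im = D (.inr i) (.inl j) - D (.inl i) (.inr j)) :
    frob M ≤ 2 * frobR D := by
  have hD : 0 ≤ (Dᵀ * D).trace := by
    rw [trace_transpose_mul_self_eq_sum]; positivity
  refine Real.sqrt_le_iff.mpr ⟨by unfold frobR; positivity, ?_⟩
  rw [mul_pow, frobR, Real.sq_sqrt hD, re_trace_conjTranspose_mul_self,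
    trace_transpose_mul_self_eq_sum]
  simp only [Fintype.sum_sum_type, ← Finset.sum_add_distrib, Finset.mul_sum]
  gcongr with j _ i _
  rw [hre, him]
  nlinarith [sq_nonneg (D (.inl i) (.inl j) - D (.inr i) (.inr j)),
    sq_nonneg (D (.inr i) (.inl j) + D (.inl i) (.inr j)),
    sq_nonneg (D (.inl i) (.inl j) + D (.inr i) (.inr j)),
    sq_nonneg (D (.inr i) (.inl j) - D (.inl i) (.inr j))]

/-- The distance between complex principal subspaces is bounded by twice the distance
between their realifications: with `Ũ = [Re U; Im U]`, `Ũ' = [Re U'; Im U']`,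
`‖UU† − U'U'†‖_F ≤ 2‖ŨŨᵀ − Ũ'Ũ'ᵀ‖_F`. -/
theorem complex_subspace_dist_le_realified {p d : ℕ}
    (U U' : Matrix (Fin p) (Fin d) ℂ)
    (hU : Uᴴ * U = 1) (hU' : U'ᴴ * U' = 1) :
    frob (U * Uᴴ - U' * U'ᴴ) ≤
      2 * frobR
        (Matrix.fromRows (U.map Complex.re) (U.map Complex.im) *
            (Matrix.fromRows (U.map Complex.re) (U.map Complex.im))ᵀ -
          Matrix.fromRows (U'.map Complex.re) (U'.map Complex.im) *
            (Matrix.fromRows (U'.map Complex.re) (U'.map Complex.im))ᵀ) := by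
  apply frob_le_two_mul_frobR_of_blocks <;> intro i j
  · simp [Matrix.mul_apply, Finset.sum_add_distrib]
    ring
  · simp [Matrix.mul_apply, Finset.sum_add_distrib]
    ring
end
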